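/- Let * be a truncation on a vector lattice L, let P be a proper prime ideal of L, let u ∈ π*(P), and let f ∈ P. Then {α ∈ ℝ : (f − α u*)⁺ ∈ P} = [0, ∞); in particular, the infimum of this set is 0 (i.e., the representing function of f takes the value 0 at P). -/

import Mathlib

/-- A truncation on a vector lattice `L`: a map sending each positive element to a
positive element, not identically zero on the positive cone, satisfying
(a) `f ⊓ g* ≤ f* ≤ f` for all `f, g ∈ L⁺`, and
(b) if `f ∈ L⁺` and `(n • f)* = n • f` for all `n ≥ 1`, then `f = 0`. -/
structure Truncation (L : Type*) [Lattice L] [AddCommGroup L] where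
  toFun : L → L
  map_nonneg' : ∀ f : L, 0 ≤ f → 0 ≤ toFun f
  nonzero' : ∃ f : L, 0 ≤ f ∧ toFun f ≠ 0
  inf_le' : ∀ f g : L, 0 ≤ f → 0 ≤ g → f ⊓ toFun g ≤ toFun f
  le_self' : ∀ f : L, 0 ≤ f → toFun f ≤ f
  arch' : ∀ f : L, 0 ≤ f → (∀ n : ℕ, 1 ≤ n → toFun (n • f) = n • f) → f = 0

/-- An (order) ideal of a vector lattice: a vector subspace which is solid. -/
def IsLatticeIdeal {L : Type*} [Lattice L] [AddCommGroup L] [Module ℝ L]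
    (P : Submodule ℝ L) : Prop :=
  ∀ f ∈ P, ∀ g : L, |g| ≤ |f| → g ∈ P

/-- A proper prime ideal of a vector lattice: a solid vector subspace `P ≠ L`
such that `f ⊓ g ∈ P` implies `f ∈ P` or `g ∈ P`. -/
def IsProperPrimeIdeal {L : Type*} [Lattice L] [AddCommGroup L] [Module ℝ L]
    (P : Submodule ℝ L) : Prop :=
  IsLatticeIdeal P ∧ P ≠ ⊤ ∧ ∀ f g : L, f ⊓ g ∈ P → f ∈ P ∨ g ∈ P

theorem IsLatticeIdeal.mem_of_nonneg_of_le {L : Type*} [Lattice L] [AddCommGroup L]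
    [CovariantClass L L (· + ·) (· ≤ ·)] [Module ℝ L] {P : Submodule ℝ L}
    (hP : IsLatticeIdeal P) {f g : L} (hf : f ∈ P) (hg : 0 ≤ g) (hgf : g ≤ f) : g ∈ P := by
  have : AddLeftMono L := ‹_›
  refine hP f hf g ?_
  rwa [abs_of_nonneg hg, abs_of_nonneg (hg.trans hgf)]

theorem IsLatticeIdeal.abs_mem {L : Type*} [Lattice L] [AddCommGroup L]
    [CovariantClass L L (· + ·) (· ≤ ·)] [Module ℝ L] {P : Submodule ℝ L}
    (hP : IsLatticeIdeal P) {f : L} (hf : f ∈ P) : |f| ∈ P := by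
  have : AddLeftMono L := ‹_›
  exact hP f hf |f| (abs_abs f).le

theorem Truncation.toFun_sub_toFun_le {L : Type*} [Lattice L] [AddCommGroup L]
    [CovariantClass L L (· + ·) (· ≤ ·)] (t : Truncation L) {u : L} (hu : 0 ≤ u) :
    t.toFun (u - t.toFun u) ≤ t.toFun u := by
  have : AddLeftMono L := ‹_›
  have h0 : 0 ≤ u - t.toFun u := sub_nonneg.2 (t.le_self' u hu)
  exact (le_inf ((t.le_self' _ h0).trans (sub_le_self u (t.map_nonneg' u hu))) le_rfl).trans
    (t.inf_le' u _ hu h0)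

/-- Let `*` be a truncation on a vector lattice `L`, `P` a proper prime ideal of `L`,
`u ∈ π*(P)` (i.e. `0 ≤ u` and `(u - u*)* ∉ P`), and `f ∈ P`. Then
`{α ∈ ℝ : (f - α • u*)⁺ ∈ P} = [0, ∞)`, and in particular its infimum is `0`. -/
theorem stmt_18 {L : Type*} [Lattice L] [AddCommGroup L]
    [CovariantClass L L (· + ·) (· ≤ ·)] [Module ℝ L] [PosSMulMono ℝ L]
    (t : Truncation L) (P : Submodule ℝ L) (hP : IsProperPrimeIdeal P)
    (u : L) (hu : 0 ≤ u) (hu' : t.toFun (u - t.toFun u) ∉ P)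
    (f : L) (hf : f ∈ P) :
    {α : ℝ | (f - α • t.toFun u) ⊔ 0 ∈ P} = Set.Ici (0 : ℝ) ∧
      sInf {α : ℝ | (f - α • t.toFun u) ⊔ 0 ∈ P} = 0 := by
  have : AddLeftMono L := ‹_›
  have hPi := hP.1
  have hs : 0 ≤ t.toFun u := t.map_nonneg' u hu
  have hsP : t.toFun u ∉ P := fun h ↦ hu' (hPi.mem_of_nonneg_of_le h
    (t.map_nonneg' _ (sub_nonneg.2 (t.le_self' u hu))) (t.toFun_sub_toFun_le hu))
  have key : {α : ℝ | (f - α • t.toFun u) ⊔ 0 ∈ P} = Set.Ici (0 : ℝ) := by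
    ext α
    simp only [Set.mem_ofPred_eq, Set.mem_Ici]
    constructor
    · intro h
      by_contra! hα
      have hle : (-α) • t.toFun u ≤ (f - α • t.toFun u) ⊔ 0 + |f| :=
        calc (-α) • t.toFun u = (f - α • t.toFun u) + -f := by rw [neg_smul]; abel
          _ ≤ _ := add_le_add le_sup_left (neg_le_abs f)
      have hmem := hPi.mem_of_nonneg_of_le (P.add_mem h (hPi.abs_mem hf))
        (smul_nonneg (neg_nonneg.2 hα.le) hs) hle
      exact hsP ((P.smul_mem_iff (neg_ne_zero.2 hα.ne)).1 hmem)
    · intro hα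
      exact hPi.mem_of_nonneg_of_le (hPi.abs_mem hf) le_sup_right
        (sup_le ((sub_le_self f (smul_nonneg hα hs)).trans (le_abs_self f)) (abs_nonneg f))
  exact ⟨key, by rw [key, csInf_Ici]⟩
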